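/- arXiv:2401.17604 — 4 statements merged into one kernel-verified Lean document; each statement's English description precedes it below -/
import Mathlib

section
/- (Distributional Johnson–Lindenstrauss norm preservation.) Let T, k ≥ 1 be integers and ε ∈ (0, 1). Let R be a random k×T matrix whose entries are i.i.d. Gaussian random variables with mean 0 and variance 1/k, modeled by the product of Gaussian measures on ℝ^{k×T}. Then for every fixed vector x ∈ ℝ^T, the probability of the event (1 − ε)‖x‖₂² ≤ ‖R x‖₂² ≤ (1 + ε)‖x‖₂² is at least 1 − 2·exp(−(ε² − ε³)·k / 4). -/
open MeasureTheory ProbabilityTheory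
open scoped ENNReal NNReal

lemma jl_log_one {ε : ℝ} (h0 : 0 < ε) (h1 : ε < 1) :
    Real.log (1 + ε) ≤ ε - (ε ^ 2 - ε ^ 3) / 2 := by
  rw [Real.log_le_iff_le_exp (by linarith)]
  have hy : 0 ≤ ε - (ε ^ 2 - ε ^ 3) / 2 := by
    nlinarith [pow_pos h0 3, mul_pos h0 h0]
  refine le_trans ?_ (Real.quadratic_le_exp_of_nonneg hy)
  have e : 1 + (ε - (ε ^ 2 - ε ^ 3) / 2) + (ε - (ε ^ 2 - ε ^ 3) / 2) ^ 2 / 2 - (1 + ε)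
    = ε ^ 2 / 2 * (ε ^ 2 + (ε / 2 - ε ^ 2 / 2) ^ 2) := by ring
  have : 0 ≤ ε ^ 2 / 2 * (ε ^ 2 + (ε / 2 - ε ^ 2 / 2) ^ 2) := by positivity
  linarith

lemma jl_log_two {ε : ℝ} (h0 : 0 < ε) (h1 : ε < 1) :
    Real.log (1 - ε) ≤ -ε - (ε ^ 2 - ε ^ 3) / 2 := by
  have h := Real.hasSum_pow_div_log_of_abs_lt_one (x := ε) (by rw [abs_lt]; constructor <;> linarith)
  have h2 := sum_le_hasSum (Finset.range 2) (fun i _ => by positivity) h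
  norm_num [Finset.sum_range_succ] at h2
  have := pow_pos h0 3
  linarith

/-- mgf of square -/
lemma jl_sq {v : ℝ≥0} (hv : v ≠ 0) {t : ℝ} (ht : 2 * t * v < 1) :
    Integrable (fun y : ℝ => Real.exp (t * y ^ 2)) (gaussianReal 0 v) ∧
    ∫ y, Real.exp (t * y ^ 2) ∂(gaussianReal 0 v) = (√(1 - 2 * t * v))⁻¹ := by
  have hv' : (0 : ℝ) < v := by positivity
  have e : ∀ y : ℝ, gaussianPDFReal 0 v y • Real.exp (t * y ^ 2)
      = (√(2 * Real.pi * v))⁻¹ * Real.exp (-((1 - 2 * t * v) / (2 * v)) * y ^ 2) := by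
    intro y
    rw [gaussianPDFReal, smul_eq_mul, mul_assoc, ← Real.exp_add]
    congr 2
    field_simp
    ring
  have hb : 0 < (1 - 2 * t * v) / (2 * v) := by
    apply div_pos <;> linarith
  constructor
  · rw [gaussianReal_of_var_ne_zero _ hv,
      integrable_withDensity_iff_integrable_smul' (measurable_gaussianPDF _ _)
        (ae_of_all _ fun _ ↦ gaussianPDF_lt_top)]
    simp only [toReal_gaussianPDF, e]
    exact (integrable_exp_neg_mul_sq hb).const_mul _
  · rw [integral_gaussianReal_eq_integral_smul hv]
    simp only [e]
    rw [integral_const_mul, integral_gaussian, ← Real.sqrt_inv, ← Real.sqrt_inv,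
      ← Real.sqrt_mul (by positivity)]
    congr 1
    have : 1 - 2 * t * v ≠ 0 := by linarith
    field_simp

lemma jl_sum {T : ℕ} (v : ℝ≥0) (x : Fin T → ℝ) :
    (Measure.pi fun _ : Fin T => gaussianReal 0 v).map (fun u => ∑ j, u j * x j)
      = gaussianReal 0 (∑ j, ‖x j‖₊ ^ 2 * v) := by
  refine Measure.ext_of_charFun ?_
  ext t
  have hi : iIndepFun (fun j (u : Fin T → ℝ) => u j * x j)
      (Measure.pi fun _ : Fin T => gaussianReal 0 v) :=
    iIndepFun_pi (X := fun j y => y * x j) (by fun_prop)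
  rw [hi.charFun_map_fun_sum_eq_prod (fun i => Measurable.aemeasurable (by fun_prop))]
  have hm : ∀ j, (Measure.pi fun _ : Fin T => gaussianReal 0 v).map (fun u => u j * x j)
      = gaussianReal 0 (‖x j‖₊ ^ 2 * v) := by
    intro j
    have := (measurePreserving_eval (fun _ : Fin T => gaussianReal 0 v) j).map_eq
    change Measure.map ((fun y : ℝ => y * x j) ∘ (Function.eval j : (Fin T → ℝ) → ℝ)) _ = _
    rw [← Measure.map_map (by fun_prop) (by fun_prop), this, gaussianReal_map_mul_const, mul_zero]
    congr 2
    ext; simp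
  simp only [hm, charFun_gaussianReal, Finset.prod_apply]
  rw [← Complex.exp_sum]
  congr 1
  push_cast
  simp only [Finset.sum_mul, Finset.sum_div]
  simp

lemma jl_law {T k : ℕ} (v : ℝ≥0) (x : Fin T → ℝ) :
    (Measure.pi fun _ : Fin k × Fin T => gaussianReal 0 v).map
      (fun ω i => ∑ j, ω (i, j) * x j)
      = Measure.pi fun _ : Fin k => gaussianReal 0 (∑ j, ‖x j‖₊ ^ 2 * v) := by
  have h : (Measure.pi fun _ : Fin k × Fin T => gaussianReal 0 v)
     = (Measure.pi fun _ : Fin k => Measure.pi fun _ : Fin T => gaussianReal 0 v).map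
        (fun w p => w p.1 p.2) := by
    refine Measure.pi_eq fun s hs => ?_
    rw [Measure.map_apply (by fun_prop) (MeasurableSet.univ_pi hs)]
    have : (fun (w : Fin k → Fin T → ℝ) (p : Fin k × Fin T) => w p.1 p.2) ⁻¹' (Set.univ.pi s)
      = Set.univ.pi fun i => Set.univ.pi fun j => s (i, j) := by
      ext w; simp [Set.mem_pi]
    rw [this, Measure.pi_pi]
    simp only [Measure.pi_pi, Fintype.prod_prod_type]
  rw [h, Measure.map_map (by fun_prop) (by fun_prop)]
  have h2 := Measure.pi_map_pi (μ := fun _ : Fin k => Measure.pi fun _ : Fin T => gaussianReal 0 v)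
    (f := fun _ u => ∑ j, u j * x j) (fun i => Measurable.aemeasurable (by fun_prop))
  simp only [jl_sum] at h2
  exact h2

lemma jl_mgf {k : ℕ} {v : ℝ≥0} (hv : v ≠ 0) {t : ℝ} (ht : 2 * t * v < 1) :
    Integrable (fun y : Fin k → ℝ => Real.exp (t * ∑ i, y i ^ 2))
      (Measure.pi fun _ : Fin k => gaussianReal 0 v) ∧
    mgf (fun y => ∑ i, y i ^ 2) (Measure.pi fun _ : Fin k => gaussianReal 0 v) t
      = (√(1 - 2 * t * v))⁻¹ ^ k := by
  obtain ⟨h1, h2⟩ := jl_sq hv ht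
  simp only [mgf, Finset.mul_sum, Real.exp_sum]
  constructor
  · exact Integrable.fintype_prod (f := fun _ y => Real.exp (t * y ^ 2)) (fun _ => h1)
  · rw [integral_fintype_prod_eq_prod (f := fun _ y => Real.exp (t * y ^ 2))]
    simp [h2]

/-- the Chernoff bound value -/
lemma jl_val {k : ℕ} {a s c : ℝ} (ha : 0 < a) (hs : 0 < s) (hk : 0 < k)
    (hlog : Real.log a ≤ a - 1 - c / 2) :
    Real.exp (-(k * (1 - a⁻¹) / (2 * s)) * (a * s)) *
      (√(1 - 2 * (k * (1 - a⁻¹) / (2 * s)) * (s / k)))⁻¹ ^ k ≤ Real.exp (-c * k / 4) := by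
  have hk' : (0 : ℝ) < k := by exact_mod_cast hk
  have e1 : 1 - 2 * (k * (1 - a⁻¹) / (2 * s)) * (s / k) = a⁻¹ := by field_simp; ring
  have e2 : (√(a⁻¹))⁻¹ = Real.exp (Real.log a / 2) := by
    rw [Real.sqrt_inv, inv_inv, Real.sqrt_eq_rpow, Real.rpow_def_of_pos ha]
    congr 1; ring
  rw [e1, e2, ← Real.exp_nat_mul, ← Real.exp_add, Real.exp_le_exp]
  have e3 : -(k * (1 - a⁻¹) / (2 * s)) * (a * s) = k * ((1 - a) / 2) := by
    field_simp; ring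
  rw [e3]
  nlinarith

theorem jl_norm_preservation
    (T k : ℕ) (hT : 1 ≤ T) (hk : 1 ≤ k) (ε : ℝ) (hε : ε ∈ Set.Ioo (0 : ℝ) 1)
    (x : Fin T → ℝ) :
    ENNReal.ofReal (1 - 2 * Real.exp (-(ε ^ 2 - ε ^ 3) * k / 4)) ≤
      (Measure.pi fun _ : Fin k × Fin T => gaussianReal 0 (k : ℝ≥0)⁻¹)
        {ω : Fin k × Fin T → ℝ |
          (1 - ε) * ∑ j, (x j) ^ 2 ≤
              ∑ i, ((Matrix.of fun i j => ω (i, j)).mulVec x i) ^ 2 ∧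
            ∑ i, ((Matrix.of fun i j => ω (i, j)).mulVec x i) ^ 2 ≤
              (1 + ε) * ∑ j, (x j) ^ 2} := by
  obtain ⟨h0, h1⟩ := hε
  have hk' : (0 : ℝ) < k := by exact_mod_cast hk
  rcases (Finset.sum_nonneg (fun j _ => sq_nonneg (x j)) :
    0 ≤ ∑ j, (x j) ^ 2).eq_or_lt with hs | hs
  · have hx : x = 0 := by
      ext j
      have := (Finset.sum_eq_zero_iff_of_nonneg (fun j _ => sq_nonneg (x j))).1 hs.symm j
        (Finset.mem_univ j)
      simpa using this
    subst hx
    simp only [Matrix.mulVec_zero, Pi.zero_apply]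
    norm_num
    positivity
  set s := ∑ j, (x j) ^ 2 with hsdef
  set v : ℝ≥0 := ∑ j, ‖x j‖₊ ^ 2 * (k : ℝ≥0)⁻¹ with hvdef
  have hvs : (v : ℝ) = s / k := by
    rw [hvdef, hsdef]; push_cast; simp [Finset.sum_mul, div_eq_mul_inv]
  have hv : v ≠ 0 := by
    have : (0 : ℝ) < v := by rw [hvs]; positivity
    intro h; simp [h] at this
  have hset : MeasurableSet {y : Fin k → ℝ | (1 - ε) * s ≤ ∑ i, y i ^ 2 ∧
      ∑ i, y i ^ 2 ≤ (1 + ε) * s} := by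
    have hm : Measurable fun y : Fin k → ℝ => ∑ i, y i ^ 2 := by fun_prop
    exact (measurableSet_le measurable_const hm).inter (measurableSet_le hm measurable_const)
  have hmap := jl_law (k := k) (k : ℝ≥0)⁻¹ x
  rw [← hvdef] at hmap
  have key : (Measure.pi fun _ : Fin k × Fin T => gaussianReal 0 (k : ℝ≥0)⁻¹)
        {ω : Fin k × Fin T → ℝ |
          (1 - ε) * s ≤
              ∑ i, ((Matrix.of fun i j => ω (i, j)).mulVec x i) ^ 2 ∧
            ∑ i, ((Matrix.of fun i j => ω (i, j)).mulVec x i) ^ 2 ≤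
              (1 + ε) * s} = (Measure.pi fun _ : Fin k => gaussianReal 0 v)
        {y : Fin k → ℝ | (1 - ε) * s ≤ ∑ i, y i ^ 2 ∧ ∑ i, y i ^ 2 ≤ (1 + ε) * s} := by
    rw [← hmap, Measure.map_apply (by fun_prop) hset]
    rfl
  rw [key]
  set P := Measure.pi fun _ : Fin k => gaussianReal 0 v
  have bound : ∀ a : ℝ, 0 < a → 2 * (k * (1 - a⁻¹) / (2 * s)) * v < 1 := by
    intro a ha
    rw [hvs]
    have : 2 * (k * (1 - a⁻¹) / (2 * s)) * (s / k) = 1 - a⁻¹ := by field_simp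
    rw [this]
    have := inv_pos.2 ha
    linarith
  have U : P.real {y | (1 + ε) * s ≤ ∑ i, y i ^ 2} ≤ Real.exp (-(ε ^ 2 - ε ^ 3) * k / 4) := by
    obtain ⟨i1, i2⟩ := jl_mgf (k := k) hv (bound (1 + ε) (by linarith))
    have h := measure_ge_le_exp_mul_mgf ((1 + ε) * s) (by
      have : (1 + ε)⁻¹ ≤ 1 := inv_le_one_of_one_le₀ (by linarith)
      have : 0 ≤ 1 - (1 + ε)⁻¹ := by linarith
      positivity) i1
    rw [i2, hvs] at h
    refine h.trans (jl_val (by linarith) hs hk ?_)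
    have := jl_log_one h0 h1
    linarith
  have L : P.real {y | ∑ i, y i ^ 2 ≤ (1 - ε) * s} ≤ Real.exp (-(ε ^ 2 - ε ^ 3) * k / 4) := by
    obtain ⟨i1, i2⟩ := jl_mgf (k := k) hv (bound (1 - ε) (by linarith))
    have h := measure_le_le_exp_mul_mgf ((1 - ε) * s) (by
      have : 1 ≤ (1 - ε)⁻¹ := (one_le_inv₀ (by linarith)).2 (by linarith)
      apply div_nonpos_of_nonpos_of_nonneg
      · apply mul_nonpos_of_nonneg_of_nonpos hk'.le; linarith
      · positivity) i1
    rw [i2, hvs] at h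
    refine h.trans (jl_val (by linarith) hs hk ?_)
    have := jl_log_two h0 h1
    linarith
  rw [← ofReal_measureReal]
  apply ENNReal.ofReal_le_ofReal
  have hc := probReal_compl_eq_one_sub (μ := P) hset
  have hsub : P.real {y : Fin k → ℝ | (1 - ε) * s ≤ ∑ i, y i ^ 2 ∧
      ∑ i, y i ^ 2 ≤ (1 + ε) * s}ᶜ ≤ P.real ({y | (1 + ε) * s ≤ ∑ i, y i ^ 2} ∪
        {y | ∑ i, y i ^ 2 ≤ (1 - ε) * s}) := by
    refine measureReal_mono ?_ (measure_ne_top _ _)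
    intro y hy
    simp only [Set.mem_compl_iff, Set.mem_ofPred_eq, not_and_or, not_le] at hy
    rcases hy with hy | hy
    · right; exact hy.le
    · left; exact hy.le
  have := measureReal_union_le (μ := P) {y | (1 + ε) * s ≤ ∑ i, y i ^ 2}
        {y | ∑ i, y i ^ 2 ≤ (1 - ε) * s}
  linarith
end

section
/- (Chi-squared concentration underlying the Johnson–Lindenstrauss lemma.) Let k ≥ 1 be an integer and ε ∈ (0, 1). Let g₁, …, g_k be i.i.d. standard Gaussian random variables (mean 0, variance 1), modeled by the k-fold product of the standard Gaussian measure on ℝ. Then the probability of the event | (1/k) Σ_{i=1}^{k} g_i² − 1 | ≥ ε is at most 2·exp(−(ε² − ε³)·k / 4). -/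
open MeasureTheory ProbabilityTheory
open scoped ENNReal NNReal

theorem aux_gauss_int (t : ℝ) :
    (fun x : ℝ => gaussianPDFReal 0 1 x • Real.exp (t * x ^ 2)) =
      fun x => (√(2 * Real.pi))⁻¹ * Real.exp (-(1 / 2 - t) * x ^ 2) := by
  funext x
  simp only [gaussianPDFReal, smul_eq_mul, NNReal.coe_one, mul_one, sub_zero]
  rw [mul_assoc, ← Real.exp_add]
  congr 2
  ring

theorem aux_integrable (t : ℝ) (ht : t < 1 / 2) :
    Integrable (fun x : ℝ => Real.exp (t * x ^ 2)) (gaussianReal 0 1) := by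
  rw [gaussianReal_of_var_ne_zero 0 one_ne_zero]
  rw [integrable_withDensity_iff_integrable_smul' (measurable_gaussianPDF 0 1)
    (ae_of_all _ fun x => ENNReal.ofReal_lt_top)]
  simp only [toReal_gaussianPDF]
  rw [aux_gauss_int]
  exact (integrable_exp_neg_mul_sq (by linarith)).const_mul _

theorem aux_integral (u : ℝ) (hu : 0 < u) :
    ∫ x, Real.exp ((1 - 1 / u) / 2 * x ^ 2) ∂(gaussianReal 0 1) = √u := by
  rw [integral_gaussianReal_eq_integral_smul one_ne_zero, aux_gauss_int,
    integral_const_mul, integral_gaussian, ← Real.sqrt_inv, ← Real.sqrt_mul (by positivity)]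
  congr 1
  have := Real.pi_pos.ne'
  have h : (1 / 2 - (1 - 1 / u) / 2) = 1 / (2 * u) := by field_simp; ring
  rw [h]
  field_simp

theorem aux_chernoff (k : ℕ) (u : ℝ) (hu : 0 < u) (A : Set (Fin k → ℝ))
    (hA : ∀ g ∈ A, (1 - 1 / u) / 2 * (u * k) ≤ (1 - 1 / u) / 2 * ∑ i, (g i) ^ 2) :
    (Measure.pi fun _ : Fin k => gaussianReal 0 1) A ≤
      ENNReal.ofReal (Real.exp (k / 2 * (Real.log u - (u - 1)))) := by
  set μ := Measure.pi fun _ : Fin k => gaussianReal 0 1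
  set t := (1 - 1 / u) / 2 with ht
  have htlt : t < 1 / 2 := by
    have : 0 < 1 / u := by positivity
    rw [ht]; linarith
  set F : (Fin k → ℝ) → ℝ := fun g => ∏ i, Real.exp (t * (g i) ^ 2) with hF
  have hFi : Integrable F μ :=
    Integrable.fintype_prod (f := fun _ (x : ℝ) => Real.exp (t * x ^ 2))
      (fun _ => aux_integrable t htlt)
  have hFint : ∫ g, F g ∂μ = √u ^ k := by
    have := integral_fintype_prod_eq_pow (ι := Fin k) (μ := gaussianReal 0 1)
      (fun x : ℝ => Real.exp (t * x ^ 2))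
    rw [aux_integral u hu, Fintype.card_fin] at this
    exact this
  have hFe : ∀ g, F g = Real.exp (t * ∑ i, (g i) ^ 2) := by
    intro g
    simp only [hF]
    rw [← Real.exp_sum, Finset.mul_sum]
  have hm := mul_meas_ge_le_integral_of_nonneg (μ := μ) (f := F)
    (ae_of_all _ fun g => by rw [hFe]; exact (Real.exp_pos _).le) hFi (Real.exp (t * (u * k)))
  rw [hFint] at hm
  have hsub : μ A ≤ μ {g | Real.exp (t * (u * k)) ≤ F g} := by
    apply measure_mono
    intro g hg
    simp only [Set.mem_setOf_eq, hFe]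
    exact Real.exp_le_exp.2 (hA g hg)
  refine hsub.trans ?_
  rw [← ofReal_measureReal]
  apply ENNReal.ofReal_le_ofReal
  have hs : √u ^ k = Real.exp (k / 2 * Real.log u) := by
    rw [← Real.exp_log (Real.sqrt_pos.2 hu), ← Real.exp_nat_mul, Real.log_sqrt hu.le]
    congr 1; ring
  have he : k / 2 * (Real.log u - (u - 1)) = k / 2 * Real.log u - t * (u * k) := by
    rw [ht]; field_simp
  rw [he, Real.exp_sub, ← hs, le_div_iff₀ (Real.exp_pos _), mul_comm]
  exact hm

theorem aux_log_upper (e : ℝ) (h0 : 0 < e) :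
    Real.log (1 + e) ≤ e - e ^ 2 / 2 + e ^ 3 / 2 := by
  have hd : ∀ x : ℝ, 0 ≤ x → HasDerivAt
      (fun x : ℝ => x - x ^ 2 / 2 + x ^ 3 / 2 - Real.log (1 + x))
      (1 - x + 3 * x ^ 2 / 2 - 1 / (1 + x)) x := by
    intro x hx
    have h1 : HasDerivAt (fun x : ℝ => Real.log (1 + x)) (1 / (1 + x)) x :=
      ((hasDerivAt_id x).const_add 1).log (by simp; linarith)
    have h2 := (((hasDerivAt_id x).sub ((hasDerivAt_pow 2 x).div_const 2)).add
      ((hasDerivAt_pow 3 x).div_const 2)).sub h1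
    refine h2.congr_deriv ?_
    norm_num
  have hmono : MonotoneOn (fun x : ℝ => x - x ^ 2 / 2 + x ^ 3 / 2 - Real.log (1 + x))
      (Set.Ici 0) := by
    apply monotoneOn_of_deriv_nonneg (convex_Ici 0)
    · intro x hx
      exact (hd x hx).continuousAt.continuousWithinAt
    · intro x hx
      rw [interior_Ici] at hx
      exact (hd x (le_of_lt hx)).differentiableAt.differentiableWithinAt
    · intro x hx
      rw [interior_Ici] at hx
      have hx : 0 < x := hx
      rw [(hd x hx.le).deriv, sub_nonneg, div_le_iff₀ (by linarith)]
      nlinarith [pow_pos hx 2, pow_pos hx 3]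
  have := hmono (Set.mem_Ici.2 le_rfl) (Set.mem_Ici.2 h0.le) h0.le
  simp at this
  linarith

theorem aux_log_lower (e : ℝ) (h0 : 0 < e) (h1 : e < 1) :
    Real.log (1 - e) ≤ -e - e ^ 2 / 2 + e ^ 3 / 2 := by
  have h := Real.hasSum_pow_div_log_of_abs_lt_one (x := e) (by rw [abs_of_pos h0]; exact h1)
  have := sum_le_hasSum (Finset.range 2) (fun i _ => by positivity) h
  norm_num [Finset.sum_range_succ] at this
  nlinarith [pow_pos h0 3]

/-- Chi-squared concentration underlying the Johnson–Lindenstrauss lemma: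
for i.i.d. standard Gaussians `g₁, …, g_k` (modeled by the `k`-fold product of the
standard Gaussian measure on `ℝ`), the probability that the normalized sum of squares
deviates from `1` by at least `ε` is at most `2 · exp(−(ε² − ε³)·k / 4)`. -/
theorem chi_squared_concentration
    (k : ℕ) (hk : 1 ≤ k) (ε : ℝ) (hε : ε ∈ Set.Ioo (0 : ℝ) 1) :
    (Measure.pi fun _ : Fin k => gaussianReal 0 1)
        {g : Fin k → ℝ | ε ≤ |(1 / (k : ℝ)) * ∑ i, (g i) ^ 2 - 1|} ≤
      ENNReal.ofReal (2 * Real.exp (-(ε ^ 2 - ε ^ 3) * k / 4)) := by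

  obtain ⟨h0, h1⟩ := hε
  have hkp : (0 : ℝ) < k := by exact_mod_cast hk
  have hU := aux_chernoff k (1 + ε) (by linarith)
    {g | (1 + ε) * k ≤ ∑ i, (g i) ^ 2} (by
      intro g hg
      refine mul_le_mul_of_nonneg_left hg ?_
      have : 1 / (1 + ε) ≤ 1 := by rw [div_le_one (by linarith)]; linarith
      linarith)
  have hL := aux_chernoff k (1 - ε) (by linarith)
    {g | ∑ i, (g i) ^ 2 ≤ (1 - ε) * k} (by
      intro g hg
      refine mul_le_mul_of_nonpos_left hg ?_
      have : 1 ≤ 1 / (1 - ε) := by rw [le_div_iff₀ (by linarith)]; linarith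
      linarith)
  have hbU : Real.exp (k / 2 * (Real.log (1 + ε) - (1 + ε - 1))) ≤
      Real.exp (-(ε ^ 2 - ε ^ 3) * k / 4) := by
    apply Real.exp_le_exp.2
    have := mul_le_mul_of_nonneg_left (aux_log_upper ε h0) (half_pos hkp).le
    linarith
  have hbL : Real.exp (k / 2 * (Real.log (1 - ε) - (1 - ε - 1))) ≤
      Real.exp (-(ε ^ 2 - ε ^ 3) * k / 4) := by
    apply Real.exp_le_exp.2
    have := mul_le_mul_of_nonneg_left (aux_log_lower ε h0 h1) (half_pos hkp).le
    linarith
  have hsub : {g : Fin k → ℝ | ε ≤ |(1 / (k : ℝ)) * ∑ i, (g i) ^ 2 - 1|} ⊆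
      {g | (1 + ε) * k ≤ ∑ i, (g i) ^ 2} ∪ {g | ∑ i, (g i) ^ 2 ≤ (1 - ε) * k} := by
    intro g hg
    simp only [Set.mem_setOf_eq] at hg
    rw [one_div_mul_eq_div] at hg
    rcases le_abs.1 hg with h | h
    · left
      exact (le_div_iff₀ hkp).1 (by linarith)
    · right
      exact (div_le_iff₀ hkp).1 (by linarith)
  refine (measure_mono hsub).trans ((measure_union_le _ _).trans ?_)
  rw [two_mul, ENNReal.ofReal_add (Real.exp_pos _).le (Real.exp_pos _).le]
  exact add_le_add (hU.trans (ENNReal.ofReal_le_ofReal hbU))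
    (hL.trans (ENNReal.ofReal_le_ofReal hbL))
end

section
/- (Johnson–Lindenstrauss inner-product preservation.) Let T, k ≥ 1 be integers and ε ∈ (0, 1). Let R be a random k×T matrix whose entries are i.i.d. Gaussian random variables with mean 0 and variance 1/k, modeled by the product of Gaussian measures on ℝ^{k×T}. Then for every pair of fixed vectors u, v ∈ ℝ^T, the probability of the event | ⟨R u, R v⟩ − ⟨u, v⟩ | ≤ (ε/2)·(‖u‖₂² + ‖v‖₂²) is at least 1 − 4·exp(−(ε² − ε³)·k / 4). -/
open MeasureTheory ProbabilityTheory
open scoped ENNReal NNReal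

lemma jl_log_up {e : ℝ} (h0 : 0 ≤ e) : Real.log (1 + e) ≤ e - e ^ 2 / 2 + e ^ 3 / 2 := by
  have hd : ∀ x ∈ Set.Ici (0 : ℝ), HasDerivAt
      (fun x : ℝ => x - x ^ 2 / 2 + x ^ 3 / 2 - Real.log (1 + x))
      (1 - x + 3 * x ^ 2 / 2 - 1 / (1 + x)) x := by
    intro x hx
    have hx : (0 : ℝ) ≤ x := hx
    have h1 := ((hasDerivAt_id x).const_add 1).log (by simp; linarith)
    have h2 := (((hasDerivAt_id x).sub (((hasDerivAt_id x).pow 2).div_const 2)).add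
      (((hasDerivAt_id x).pow 3).div_const 2)).sub h1
    refine HasDerivAt.congr_deriv (f := fun x : ℝ => x - x ^ 2 / 2 + x ^ 3 / 2 - Real.log (1 + x)) h2 ?_
    simp only [id]
    norm_num
  have hm : MonotoneOn (fun x : ℝ => x - x ^ 2 / 2 + x ^ 3 / 2 - Real.log (1 + x))
      (Set.Ici 0) := by
    refine monotoneOn_of_hasDerivWithinAt_nonneg (convex_Ici 0)
      (fun x hx => (hd x hx).continuousAt.continuousWithinAt)
      (fun x hx => (hd x (interior_subset hx)).hasDerivWithinAt) ?_
    intro x hx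
    have hx : (0 : ℝ) ≤ x := interior_subset hx
    have : 1 - x + 3 * x ^ 2 / 2 - 1 / (1 + x) = (x ^ 2 / 2 + 3 * x ^ 3 / 2) / (1 + x) := by
      field_simp
      ring
    rw [this]
    positivity
  have := hm (Set.mem_Ici.2 le_rfl) (Set.mem_Ici.2 h0) h0
  simp at this
  linarith

lemma jl_log_down {e : ℝ} (h0 : 0 ≤ e) (h1 : e < 1) : Real.log (1 - e) ≤ -e - e ^ 2 / 2 := by
  have h := Real.hasSum_pow_div_log_of_abs_lt_one (x := e) (by rw [abs_of_nonneg h0]; exact h1)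
  have := sum_le_hasSum (Finset.range 2) (fun i _ => by positivity) h
  simp [Finset.sum_range_succ] at this
  norm_num at this
  linarith

lemma jl_mgf_sq (s : ℝ≥0) (hs : s ≠ 0) (t : ℝ) (ht : 2 * t * s < 1) :
    mgf (fun x => x ^ 2) (gaussianReal 0 s) t = √(1 / (1 - 2 * t * s)) := by
  have hs' : (0 : ℝ) < s := by positivity
  rw [mgf, integral_gaussianReal_eq_integral_smul hs]
  have : ∀ x : ℝ, gaussianPDFReal 0 s x • Real.exp (t * x ^ 2) =
      (√(2 * Real.pi * s))⁻¹ * Real.exp (-((1 - 2 * t * s) / (2 * s)) * x ^ 2) := by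
    intro x
    rw [gaussianPDFReal, smul_eq_mul, mul_assoc, ← Real.exp_add]
    congr 2
    field_simp
    ring
  simp_rw [this]
  rw [integral_const_mul, integral_gaussian, ← Real.sqrt_inv, ← Real.sqrt_mul (by positivity)]
  congr 1
  have : 1 - 2 * t * s ≠ 0 := by linarith
  field_simp

lemma jl_row_law (T : ℕ) (c : ℝ≥0) (w : Fin T → ℝ) :
    (Measure.pi fun _ : Fin T => gaussianReal 0 c).map (fun r => ∑ j, r j * w j) =
      gaussianReal 0 ((∑ j, ‖w j‖₊ ^ 2) * c) := by
  have hind : iIndepFun (fun (j : Fin T) (r : Fin T → ℝ) => r j * w j)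
      (Measure.pi fun _ : Fin T => gaussianReal 0 c) :=
    iIndepFun_pi (X := fun j x => x * w j) (fun j => by fun_prop)
  have hone : ∀ j, (Measure.pi fun _ : Fin T => gaussianReal 0 c).map
      (fun r => r j * w j) = gaussianReal 0 (‖w j‖₊ ^ 2 * c) := by
    intro j
    have h1 := (measurePreserving_eval (fun _ : Fin T => gaussianReal 0 c) j).map_eq
    have h2 := gaussianReal_map_mul_const (μ := 0) (v := c) (w j)
    rw [← h1, Measure.map_map (by fun_prop) (by fun_prop)] at h2
    refine Eq.trans h2 ?_
    rw [mul_zero]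
    congr 2
    ext
    simp
  have key : ∀ S : Finset (Fin T), (Measure.pi fun _ : Fin T => gaussianReal 0 c).map
      (∑ j ∈ S, fun r : Fin T → ℝ => r j * w j) =
      gaussianReal 0 ((∑ j ∈ S, ‖w j‖₊ ^ 2) * c) := by
    intro S
    induction S using Finset.induction_on with
    | empty =>
      simp only [Finset.sum_empty, zero_mul, gaussianReal_zero_var]
      change Measure.map (fun _ => (0 : ℝ)) _ = _
      rw [Measure.map_const]
      simp
    | insert a S ha ih =>
      rw [Finset.sum_insert ha, Finset.sum_insert ha, add_mul]
      have := gaussianReal_add_gaussianReal_of_indepFun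
        (hind.indepFun_finsetSum_of_notMem (fun j => by fun_prop) ha).symm (hone a) ih
      simpa using this
  rw [← key Finset.univ]
  congr 1
  ext r
  simp

lemma jl_curry (T k : ℕ) (c : ℝ≥0) :
    (Measure.pi fun _ : Fin k × Fin T => gaussianReal 0 c) =
      (Measure.pi fun _ : Fin k => Measure.pi fun _ : Fin T => gaussianReal 0 c).map
        (fun r p => r p.1 p.2) := by
  refine (Measure.pi_eq fun s hs => ?_)
  rw [Measure.map_apply (by fun_prop) (MeasurableSet.univ_pi hs)]
  have : (fun (r : Fin k → Fin T → ℝ) (p : Fin k × Fin T) => r p.1 p.2) ⁻¹' Set.univ.pi s =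
      Set.univ.pi (fun i => Set.univ.pi fun j => s (i, j)) := by
    ext r
    simp
  rw [this, Measure.pi_pi]
  simp_rw [Measure.pi_pi]
  rw [Fintype.prod_prod_type]

lemma jl_mgf_sum (T k : ℕ) (c : ℝ≥0) (w : Fin T → ℝ) (hs : (∑ j, ‖w j‖₊ ^ 2) * c ≠ 0)
    (t : ℝ) (ht : 2 * t * ((∑ j, w j ^ 2) * c) < 1) :
    mgf (fun r : Fin k → Fin T → ℝ => ∑ i, (∑ j, r i j * w j) ^ 2)
      (Measure.pi fun _ : Fin k => Measure.pi fun _ : Fin T => gaussianReal 0 c) t =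
      √(1 / (1 - 2 * t * ((∑ j, w j ^ 2) * c))) ^ k := by
  have hind : iIndepFun (fun (i : Fin k) (r : Fin k → Fin T → ℝ) => (∑ j, r i j * w j) ^ 2)
      (Measure.pi fun _ : Fin k => Measure.pi fun _ : Fin T => gaussianReal 0 c) :=
    iIndepFun_pi (X := fun _ (x : Fin T → ℝ) => (∑ j, x j * w j) ^ 2)
      (fun j => Measurable.aemeasurable (by fun_prop))
  have h := hind.mgf_sum (t := t) (fun i => by fun_prop) Finset.univ
  have e : (∑ i : Fin k, fun (r : Fin k → Fin T → ℝ) => (∑ j, r i j * w j) ^ 2) =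
      fun r => ∑ i, (∑ j, r i j * w j) ^ 2 := by
    ext r
    simp
  rw [e] at h
  rw [h]
  have hcoe : (((∑ j, ‖w j‖₊ ^ 2) * c : ℝ≥0) : ℝ) = (∑ j, w j ^ 2) * c := by
    push_cast
    simp
  have hrow : ∀ i : Fin k, mgf (fun r : Fin k → Fin T → ℝ => (∑ j, r i j * w j) ^ 2)
      (Measure.pi fun _ : Fin k => Measure.pi fun _ : Fin T => gaussianReal 0 c) t =
      √(1 / (1 - 2 * t * ((∑ j, w j ^ 2) * c))) := by
    intro i
    rw [← hcoe, ← jl_mgf_sq _ hs t (by rw [hcoe]; exact ht), ← jl_row_law]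
    have hev := (measurePreserving_eval
        (fun _ : Fin k => Measure.pi fun _ : Fin T => gaussianReal 0 c) i).map_eq
    have hmm : ∀ ν : Measure (Fin T → ℝ),
        Measure.map (Function.eval i)
          (Measure.pi fun _ : Fin k => Measure.pi fun _ : Fin T => gaussianReal 0 c) = ν →
        mgf (fun r : Fin k → Fin T → ℝ => (∑ j, r i j * w j) ^ 2)
          (Measure.pi fun _ : Fin k => Measure.pi fun _ : Fin T => gaussianReal 0 c) t =
        mgf (fun x => x ^ 2) (ν.map (fun r => ∑ j, r j * w j)) t := by
      rintro ν rfl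
      rw [Measure.map_map (by fun_prop) (by fun_prop)]
      unfold mgf
      rw [integral_map (Measurable.aemeasurable (by fun_prop)) (by fun_prop)]
      rfl
    exact hmm _ hev
  simp [hrow]

lemma jl_tail (T k : ℕ) (hk : 1 ≤ k) (e : ℝ) (h0 : 0 < e) (h1 : e < 1) (w : Fin T → ℝ) :
    (Measure.pi fun _ : Fin k => Measure.pi fun _ : Fin T => gaussianReal 0 (k : ℝ≥0)⁻¹).real
      {r | ¬ |(∑ i, (∑ j, r i j * w j) ^ 2) - ∑ j, w j ^ 2| ≤ e * ∑ j, w j ^ 2} ≤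
      2 * Real.exp (-(e ^ 2 - e ^ 3) * k / 4) := by
  set P := (Measure.pi fun _ : Fin k => Measure.pi fun _ : Fin T => gaussianReal 0 (k : ℝ≥0)⁻¹)
  by_cases hw : w = 0
  · subst hw
    simp
    positivity
  have hk' : (0 : ℝ) < k := by exact_mod_cast hk
  obtain ⟨j0, hj0⟩ := Function.ne_iff.1 hw
  have hs : 0 < ∑ j, w j ^ 2 :=
    Finset.sum_pos' (fun j _ => sq_nonneg _) ⟨j0, Finset.mem_univ _, by
      have : w j0 ≠ 0 := hj0
      positivity⟩
  have hne : (∑ j, ‖w j‖₊ ^ 2) * (k : ℝ≥0)⁻¹ ≠ 0 := by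
    have : (((∑ j, ‖w j‖₊ ^ 2) * (k : ℝ≥0)⁻¹ : ℝ≥0) : ℝ) ≠ 0 := by
      push_cast
      simp only [Real.norm_eq_abs, sq_abs]
      positivity
    exact_mod_cast this
  have hmgf := fun t => jl_mgf_sum T k (k : ℝ≥0)⁻¹ w hne t
  set s := ∑ j, w j ^ 2
  set Q : (Fin k → Fin T → ℝ) → ℝ := fun r => ∑ i, (∑ j, r i j * w j) ^ 2
  have hint : ∀ t, 2 * t * (s * ((k : ℝ≥0)⁻¹ : ℝ≥0)) < 1 →
      Integrable (fun r => Real.exp (t * Q r)) P := by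
    intro t ht
    by_contra hc
    have h2 := hmgf t ht
    rw [mgf, integral_undef hc] at h2
    have : 0 < 1 - 2 * t * (s * ((k : ℝ≥0)⁻¹ : ℝ≥0)) := by linarith
    have : 0 < √(1 / (1 - 2 * t * (s * ((k : ℝ≥0)⁻¹ : ℝ≥0)))) ^ k := by positivity
    linarith
  have hsqrt : ∀ x : ℝ, 0 < x → √x ^ k = Real.exp (k * (Real.log x / 2)) := by
    intro x hx
    rw [Real.exp_nat_mul, ← Real.exp_log (Real.sqrt_pos.2 hx), Real.log_sqrt hx.le]
  have hup : P.real {r | (1 + e) * s ≤ Q r} ≤ Real.exp (-(e ^ 2 - e ^ 3) * k / 4) := by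
    have hts : 2 * (e * k / (2 * s * (1 + e))) * (s * ((k : ℝ≥0)⁻¹ : ℝ≥0)) = e / (1 + e) := by
      push_cast
      field_simp
    have ht : 2 * (e * k / (2 * s * (1 + e))) * (s * ((k : ℝ≥0)⁻¹ : ℝ≥0)) < 1 := by
      rw [hts, div_lt_one (by positivity)]
      linarith
    refine (measure_ge_le_exp_mul_mgf _ (by positivity) (hint _ ht)).trans ?_
    rw [hmgf _ ht, hts, show 1 / (1 - e / (1 + e)) = 1 + e by field_simp; ring,
      hsqrt _ (by positivity), ← Real.exp_add, Real.exp_le_exp]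
    have h3 : -(e * k / (2 * s * (1 + e))) * ((1 + e) * s) = -(k * (e / 2)) := by field_simp
    rw [h3]
    have := mul_le_mul_of_nonneg_left (jl_log_up h0.le) hk'.le
    linarith
  have hdown : P.real {r | Q r ≤ (1 - e) * s} ≤ Real.exp (-(e ^ 2 - e ^ 3) * k / 4) := by
    have h1e : 0 < 1 - e := by linarith
    have hts : 2 * (-(e * k / (2 * s * (1 - e)))) * (s * ((k : ℝ≥0)⁻¹ : ℝ≥0)) =
        - (e / (1 - e)) := by
      push_cast
      field_simp
    have hpos : 0 < e / (1 - e) := by positivity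
    have ht : 2 * (-(e * k / (2 * s * (1 - e)))) * (s * ((k : ℝ≥0)⁻¹ : ℝ≥0)) < 1 := by
      rw [hts]
      linarith
    refine (measure_le_le_exp_mul_mgf _ (neg_nonpos.2 (by positivity)) (hint _ ht)).trans ?_
    rw [hmgf _ ht, hts, show 1 / (1 - -(e / (1 - e))) = 1 - e by field_simp; ring,
      hsqrt _ (by positivity), ← Real.exp_add, Real.exp_le_exp]
    have h3 : - -(e * k / (2 * s * (1 - e))) * ((1 - e) * s) = k * (e / 2) := by field_simp
    rw [h3]
    have := mul_le_mul_of_nonneg_left (jl_log_down h0.le h1) hk'.le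
    have h4 : 0 ≤ e ^ 3 * k := by positivity
    linarith
  have hsub : {r | ¬ |Q r - s| ≤ e * s} ⊆ {r | (1 + e) * s ≤ Q r} ∪ {r | Q r ≤ (1 - e) * s} := by
    intro r hr
    simp only [Set.mem_ofPred_eq, abs_le, not_and_or, not_le] at hr
    rcases hr with hr | hr
    · right
      simp only [Set.mem_ofPred_eq]
      linarith
    · left
      simp only [Set.mem_ofPred_eq]
      linarith
  calc _ ≤ P.real ({r | (1 + e) * s ≤ Q r} ∪ {r | Q r ≤ (1 - e) * s}) := measureReal_mono hsub
    _ ≤ _ := measureReal_union_le _ _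
    _ ≤ _ := by linarith

/-- Johnson–Lindenstrauss inner-product preservation: if `R` is a random `k × T` matrix
with i.i.d. Gaussian entries of mean `0` and variance `1/k` (modeled by the product of
Gaussian measures on `ℝ^{k×T}`), then for every pair of fixed vectors `u, v ∈ ℝ^T`, with
probability at least `1 − 4·exp(−(ε² − ε³)·k/4)` one has
`|⟨R u, R v⟩ − ⟨u, v⟩| ≤ (ε/2)·(‖u‖₂² + ‖v‖₂²)`
(Euclidean inner products and squared norms written as sums). -/
theorem jl_inner_product_preservation
    (T k : ℕ) (hT : 1 ≤ T) (hk : 1 ≤ k) (ε : ℝ) (hε : ε ∈ Set.Ioo (0 : ℝ) 1)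
    (u v : Fin T → ℝ) :
    ENNReal.ofReal (1 - 4 * Real.exp (-(ε ^ 2 - ε ^ 3) * k / 4)) ≤
      (Measure.pi fun _ : Fin k × Fin T => gaussianReal 0 (k : ℝ≥0)⁻¹)
        {ω : Fin k × Fin T → ℝ |
          |(∑ i, ((Matrix.of fun i j => ω (i, j)).mulVec u i) *
                ((Matrix.of fun i j => ω (i, j)).mulVec v i)) -
              ∑ j, u j * v j| ≤
            (ε / 2) * ((∑ j, (u j) ^ 2) + ∑ j, (v j) ^ 2)} := by
  rw [jl_curry]
  set P := (Measure.pi fun _ : Fin k => Measure.pi fun _ : Fin T => gaussianReal 0 (k : ℝ≥0)⁻¹)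
    with hP
  have hmv : ∀ x : Fin T → ℝ, Measurable fun ω : Fin k × Fin T → ℝ =>
      (fun i => (Matrix.of fun i j => ω (i, j)).mulVec x i) := by
    intro x
    simp only [Matrix.mulVec, dotProduct, Matrix.of_apply]
    fun_prop
  rw [Measure.map_apply (by fun_prop) (by
    refine measurableSet_le ?_ measurable_const
    have h1 := fun i => (measurable_pi_apply i).comp (hmv u)
    have h2 := fun i => (measurable_pi_apply i).comp (hmv v)
    exact ((Finset.measurable_sum _ fun i _ => (h1 i).mul (h2 i)).sub_const _).abs)]
  simp only [Matrix.mulVec, dotProduct, Matrix.of_apply, Set.preimage_ofPred_eq]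
  have hA := jl_tail T k hk ε hε.1 hε.2 (u + v)
  have hB := jl_tail T k hk ε hε.1 hε.2 (u - v)
  rw [← hP] at hA hB
  set A := {r : Fin k → Fin T → ℝ |
    ¬ |(∑ i, (∑ j, r i j * (u + v) j) ^ 2) - ∑ j, (u + v) j ^ 2| ≤ ε * ∑ j, (u + v) j ^ 2}
    with hAdef
  set B := {r : Fin k → Fin T → ℝ |
    ¬ |(∑ i, (∑ j, r i j * (u - v) j) ^ 2) - ∑ j, (u - v) j ^ 2| ≤ ε * ∑ j, (u - v) j ^ 2}
    with hBdef
  rw [ENNReal.ofReal_le_iff_le_toReal (measure_ne_top _ _)]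
  change _ ≤ P.real _
  set G := {r : Fin k → Fin T → ℝ | |∑ i, (∑ j, r i j * u j) * (∑ j, r i j * v j) -
    ∑ j, u j * v j| ≤ ε / 2 * (∑ j, u j ^ 2 + ∑ j, v j ^ 2)} with hG
  have hcov : (Set.univ : Set (Fin k → Fin T → ℝ)) ⊆ G ∪ (A ∪ B) := by
    intro r _
    by_contra hr
    simp only [Set.mem_union, not_or, hAdef, hBdef, Set.mem_ofPred_eq, not_not] at hr
    obtain ⟨hg, ha, hb⟩ := hr
    apply hg
    have e1 : ∀ i, ∑ j, r i j * (u + v) j = ∑ j, r i j * u j + ∑ j, r i j * v j := by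
      intro i
      simp [mul_add, Finset.sum_add_distrib]
    have e2 : ∀ i, ∑ j, r i j * (u - v) j = ∑ j, r i j * u j - ∑ j, r i j * v j := by
      intro i
      simp [mul_sub, Finset.sum_sub_distrib]
    have p1 : ∀ (n : ℕ) (x y : Fin n → ℝ), ∑ i, (x i + y i) ^ 2 =
        ∑ i, x i ^ 2 + ∑ i, y i ^ 2 + 2 * ∑ i, x i * y i := by
      intro n x y
      rw [Finset.mul_sum, ← Finset.sum_add_distrib, ← Finset.sum_add_distrib]
      exact Finset.sum_congr rfl fun i _ => by ring
    have p2 : ∀ (n : ℕ) (x y : Fin n → ℝ), ∑ i, (x i - y i) ^ 2 =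
        ∑ i, x i ^ 2 + ∑ i, y i ^ 2 - 2 * ∑ i, x i * y i := by
      intro n x y
      rw [Finset.mul_sum, ← Finset.sum_add_distrib, ← Finset.sum_sub_distrib]
      exact Finset.sum_congr rfl fun i _ => by ring
    simp only [e1] at ha
    simp only [e2] at hb
    simp only [Pi.add_apply, Pi.sub_apply, p1, p2] at ha hb
    rw [abs_le] at ha hb
    simp only [hG, Set.mem_ofPred_eq, abs_le]
    constructor <;> linarith [ha.1, ha.2, hb.1, hb.2]
  have h1 : P.real Set.univ ≤ P.real (G ∪ (A ∪ B)) := measureReal_mono hcov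
  have h2 := measureReal_union_le (μ := P) G (A ∪ B)
  have h3 := measureReal_union_le (μ := P) A B
  have h4 : P.real Set.univ = 1 := probReal_univ
  linarith
end

section
/- (Simultaneous norm preservation with logarithmic projection dimension.) Let T ≥ 2 be an integer, ε ∈ (0, 1), and let k be an integer with k ≥ 5 ln T / (ε² − ε³). Let R be a random k×T matrix whose entries are i.i.d. Gaussian random variables with mean 0 and variance 1/k, modeled by the product of Gaussian measures on ℝ^{k×T}. Then for any fixed vectors x₁, …, x_T ∈ ℝ^T, the probability that simultaneously for every i ∈ {1, …, T} one has (1 − ε)‖x_i‖₂² ≤ ‖R x_i‖₂² ≤ (1 + ε)‖x_i‖₂² is at least 1 − 2·T·exp(−(ε² − ε³)·k / 4), which is at least 1 − 2·T^{−1/4}. -/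
open MeasureTheory ProbabilityTheory
open scoped ENNReal NNReal

lemma curry_mp (k T : ℕ) (μ : Measure ℝ) [IsProbabilityMeasure μ] :
    MeasurePreserving (fun (w : Fin k → Fin T → ℝ) (p : Fin k × Fin T) => w p.1 p.2)
      (Measure.pi fun _ => Measure.pi fun _ => μ) (Measure.pi fun _ => μ) := by
  refine ⟨by fun_prop, ?_⟩
  symm
  apply Measure.pi_eq
  intro s hs
  rw [Measure.map_apply (by fun_prop) (MeasurableSet.univ_pi hs)]
  have : (fun (w : Fin k → Fin T → ℝ) (p : Fin k × Fin T) => w p.1 p.2) ⁻¹' (Set.univ.pi s)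
      = Set.univ.pi fun l => Set.univ.pi fun j => s (l, j) := by
    ext w; simp [Set.mem_pi]
  rw [this, Measure.pi_pi, Fintype.prod_prod_type]
  simp

lemma row_law (T : ℕ) (v : ℝ≥0) (y : Fin T → ℝ) :
    (Measure.pi fun _ : Fin T => gaussianReal 0 v).map (fun a => ∑ j, a j * y j)
      = gaussianReal 0 (v * (∑ j, (y j) ^ 2).toNNReal) := by
  have hind := iIndepFun_pi (μ := fun _ : Fin T => gaussianReal 0 v) (X := fun j a => a * y j)
    (fun i => by fun_prop)
  apply Measure.ext_of_charFun
  ext t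
  have := hind.charFun_map_fun_sum_eq_prod
    (fun i => Measurable.aemeasurable (by fun_prop))
  rw [this, charFun_gaussianReal]
  simp only [Finset.prod_apply]
  have h2 : ∀ j : Fin T, (Measure.pi fun _ : Fin T => gaussianReal 0 v).map (fun a => a j * y j)
      = gaussianReal 0 (NNReal.mk ((y j)^2) (sq_nonneg _) * v) := by
    intro j
    have := gaussianReal_map_mul_const (μ := 0) (v := v) (y j)
    rw [← (measurePreserving_eval (fun _ : Fin T => gaussianReal 0 v) j).map_eq,
      Measure.map_map (by fun_prop) (by fun_prop)] at this
    simpa [Function.comp_def] using this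
  simp only [h2, charFun_gaussianReal]
  rw [← Complex.exp_sum]
  congr 1
  have h3 : ((∑ j, (y j) ^ 2).toNNReal : ℝ) = ∑ j, (y j) ^ 2 :=
    Real.coe_toNNReal _ (by positivity)
  have h4 : (((∑ j, (y j) ^ 2).toNNReal : ℝ) : ℂ) = ∑ j, (y j : ℂ) ^ 2 := by
    rw [h3]; push_cast; rfl
  push_cast
  rw [h4]
  simp only [mul_zero, zero_mul, zero_sub, Finset.sum_neg_distrib, Finset.mul_sum, Finset.sum_mul, Finset.sum_div]
  congr 1
  refine Finset.sum_congr rfl fun j _ => ?_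
  simp [← Complex.ofReal_pow]
  left
  ring

lemma gauss_sq (v : ℝ≥0) (hv : v ≠ 0) (δ : ℝ) (hδ : -1 < δ) :
    ∫ z, Real.exp (δ / (2 * v * (1 + δ)) * z ^ 2) ∂(gaussianReal 0 v) = √(1 + δ) := by
  have hv' : (0:ℝ) < v := by positivity
  have hd : 0 < 1 + δ := by linarith
  rw [integral_gaussianReal_eq_integral_smul hv]
  have : ∀ z : ℝ, gaussianPDFReal 0 v z • Real.exp (δ / (2 * v * (1 + δ)) * z ^ 2)
      = (√(2 * Real.pi * v))⁻¹ * Real.exp (-(1 / (2 * v * (1 + δ))) * z ^ 2) := by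
    intro z
    rw [gaussianPDFReal, smul_eq_mul, mul_assoc, ← Real.exp_add]
    congr 2
    field_simp
    ring
  simp only [this]
  rw [integral_const_mul, integral_gaussian, ← Real.sqrt_inv, ← Real.sqrt_mul (by positivity)]
  congr 1
  field_simp

lemma log1 (ε : ℝ) (h0 : 0 < ε) (h1 : ε < 1) : Real.log (1 + ε) ≤ ε - (ε ^ 2 - ε ^ 3) / 2 := by
  let f : ℝ → ℝ := fun x => x - (x ^ 2 - x ^ 3) / 2 - Real.log (1 + x)
  have hd : ∀ x : ℝ, 0 ≤ x → HasDerivAt f (1 - (2 * x - 3 * x ^ 2) / 2 - 1 / (1 + x)) x := by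
    intro x hx
    have a := ((hasDerivAt_id x).const_add 1).log (by simp; linarith)
    have b := ((hasDerivAt_id x).sub ((((hasDerivAt_id x).pow 2).sub ((hasDerivAt_id x).pow 3)).div_const 2)).sub a
    refine b.congr_deriv ?_
    simp
  have hm : MonotoneOn f (Set.Ici 0) := by
    apply monotoneOn_of_deriv_nonneg (convex_Ici 0)
    · exact fun x hx => (hd x hx).continuousAt.continuousWithinAt
    · intro x hx
      rw [interior_Ici] at hx
      exact (hd x (le_of_lt hx)).differentiableAt.differentiableWithinAt
    · intro x hx
      rw [interior_Ici] at hx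
      have hx' : 0 < x := hx
      rw [(hd x hx'.le).deriv]
      have : 1 - (2 * x - 3 * x ^ 2) / 2 - 1 / (1 + x) = (x ^ 2 / 2 + 3 * x ^ 3 / 2) / (1 + x) := by
        field_simp; ring
      rw [this]; positivity
  have := hm (Set.mem_Ici.2 le_rfl) (Set.mem_Ici.2 h0.le) h0.le
  simp [f] at this
  linarith

lemma log2 (ε : ℝ) (h0 : 0 < ε) (h1 : ε < 1) : Real.log (1 + -ε) ≤ -ε - (ε ^ 2 - ε ^ 3) / 2 := by
  have h := Real.hasSum_pow_div_log_of_abs_lt_one (x := ε) (by rw [abs_of_pos h0]; exact h1)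
  have := sum_le_hasSum (Finset.range 2) (fun i _ => by positivity) h
  simp [Finset.sum_range_succ] at this
  rw [← sub_eq_add_neg]
  have : 0 < ε ^ 3 := by positivity
  norm_num at *
  linarith

lemma jl_mgf_s4 (k T : ℕ) (hk : 0 < k) (y : Fin T → ℝ) (hs : 0 < ∑ j, (y j) ^ 2) (δ : ℝ) (hδ : -1 < δ) :
    mgf (fun w : Fin k → Fin T → ℝ => ∑ l, (∑ j, w l j * y j) ^ 2)
      (Measure.pi fun _ => Measure.pi fun _ => gaussianReal 0 (k : ℝ≥0)⁻¹)
      (k * δ / (2 * (∑ j, (y j) ^ 2) * (1 + δ))) = √(1 + δ) ^ k := by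
  set t := k * δ / (2 * (∑ j, (y j) ^ 2) * (1 + δ)) with ht
  have hv : (k : ℝ≥0)⁻¹ * (∑ j, (y j) ^ 2).toNNReal ≠ 0 := by
    have : (∑ j, (y j) ^ 2).toNNReal ≠ 0 := by simpa using hs
    positivity
  have g := gauss_sq _ hv δ hδ
  rw [← row_law, integral_map (Measurable.aemeasurable (by fun_prop)) (by fun_prop)] at g
  have ht' : δ / (2 * (((k : ℝ≥0)⁻¹ * (∑ j, (y j) ^ 2).toNNReal : ℝ≥0) : ℝ) * (1 + δ)) = t := by
    rw [NNReal.coe_mul, Real.coe_toNNReal _ hs.le, ht]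
    push_cast
    have : (k : ℝ) ≠ 0 := by positivity
    have : 1 + δ ≠ 0 := by linarith
    field_simp
  rw [ht'] at g
  rw [mgf]
  simp only [Finset.mul_sum, Real.exp_sum]
  rw [integral_fintype_prod_eq_prod (f := fun (_ : Fin k) (a : Fin T → ℝ) => Real.exp (t * (∑ j, a j * y j) ^ 2))]
  simp [g]

lemma jl_bound (k : ℕ) (s δ c : ℝ) (hk : 0 < k) (hs : 0 < s) (hδ : -1 < δ) (hl : Real.log (1 + δ) ≤ δ - c / 2) :
    Real.exp (-(k * δ / (2 * s * (1 + δ))) * ((1 + δ) * s)) * √(1 + δ) ^ k ≤ Real.exp (- c * k / 4) := by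
  have hd : 0 < 1 + δ := by linarith
  have : √(1 + δ) = Real.exp (Real.log (1 + δ) / 2) := by
    rw [← Real.log_sqrt hd.le, Real.exp_log (by positivity)]
  rw [this, ← Real.exp_nat_mul, ← Real.exp_add]
  apply Real.exp_le_exp.2
  have : -(k * δ / (2 * s * (1 + δ))) * ((1 + δ) * s) = - (k * δ / 2) := by field_simp
  rw [this]
  have hk' : (0:ℝ) < k := by positivity
  nlinarith

lemma jl_one (k T : ℕ) (hk : 0 < k) (y : Fin T → ℝ) (ε : ℝ) (h0 : 0 < ε) (h1 : ε < 1) :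
    (Measure.pi fun _ : Fin k => Measure.pi fun _ : Fin T => gaussianReal 0 (k : ℝ≥0)⁻¹).real
      {w | ¬ ((1 - ε) * ∑ j, (y j) ^ 2 ≤ ∑ l, (∑ j, w l j * y j) ^ 2 ∧
        ∑ l, (∑ j, w l j * y j) ^ 2 ≤ (1 + ε) * ∑ j, (y j) ^ 2)} ≤
      2 * Real.exp (-(ε ^ 2 - ε ^ 3) * k / 4) := by
  rcases (Finset.sum_nonneg fun j (_ : j ∈ Finset.univ) => sq_nonneg (y j)).eq_or_lt with hs | hs
  · have hy : ∀ j, y j = 0 := by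
      intro j
      have := (Finset.sum_eq_zero_iff_of_nonneg (fun j _ => sq_nonneg (y j))).1 hs.symm j (Finset.mem_univ j)
      simpa using this
    simp [hy]
    positivity
  have hint : ∀ δ : ℝ, -1 < δ → Integrable (fun w : Fin k → Fin T → ℝ =>
      Real.exp ((k * δ / (2 * (∑ j, (y j) ^ 2) * (1 + δ))) * ∑ l, (∑ j, w l j * y j) ^ 2))
      (Measure.pi fun _ => Measure.pi fun _ => gaussianReal 0 (k : ℝ≥0)⁻¹) := by
    intro δ hδ
    apply Integrable.of_integral_ne_zero
    have := jl_mgf_s4 k T hk y hs δ hδ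
    rw [mgf] at this
    rw [this]
    have : 0 < 1 + δ := by linarith
    positivity
  have A := (measure_ge_le_exp_mul_mgf ((1 + ε) * ∑ j, (y j) ^ 2) (by positivity) (hint ε (by linarith)))
  have B := (measure_le_le_exp_mul_mgf ((1 + -ε) * ∑ j, (y j) ^ 2)
    (div_nonpos_of_nonpos_of_nonneg (by nlinarith [(Nat.cast_nonneg k : (0:ℝ) ≤ k)])
      (mul_nonneg (by positivity) (by linarith))) (hint (-ε) (by linarith)))
  rw [jl_mgf_s4 k T hk y hs _ (by linarith)] at A B
  have A' := A.trans (jl_bound k _ ε _ hk hs (by linarith) (log1 ε h0 h1))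
  have B' := B.trans (jl_bound k _ (-ε) _ hk hs (by linarith) (log2 ε h0 h1))
  refine (measureReal_mono ?_).trans ((measureReal_union_le _ _).trans ((add_le_add B' A').trans (by linarith)))
  intro w hw
  simp only [Set.mem_ofPred_eq, not_and_or, not_le, Set.mem_union] at hw ⊢
  rw [← sub_eq_add_neg]
  exact hw.imp le_of_lt le_of_lt
/-- Simultaneous norm preservation with logarithmic projection dimension: if `T ≥ 2`,
`ε ∈ (0,1)`, `k ≥ 5 ln T / (ε² − ε³)`, and `R` is a random `k × T` matrix with i.i.d.
Gaussian entries of mean `0` and variance `1/k`, then for any fixed vectors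
`x₁, …, x_T ∈ ℝ^T`, with probability at least `1 − 2·T·exp(−(ε² − ε³)·k/4)` we have
`(1 − ε)‖x_i‖₂² ≤ ‖R x_i‖₂² ≤ (1 + ε)‖x_i‖₂²` simultaneously for all `i`; moreover this
probability bound is at least `1 − 2·T^{−1/4}`. -/
theorem jl_simultaneous_norm_preservation
    (T k : ℕ) (hT : 2 ≤ T) (ε : ℝ) (hε : ε ∈ Set.Ioo (0 : ℝ) 1)
    (hk : 5 * Real.log T / (ε ^ 2 - ε ^ 3) ≤ (k : ℝ))
    (x : Fin T → Fin T → ℝ) :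
    (ENNReal.ofReal (1 - 2 * T * Real.exp (-(ε ^ 2 - ε ^ 3) * k / 4)) ≤
        (Measure.pi fun _ : Fin k × Fin T => gaussianReal 0 (k : ℝ≥0)⁻¹)
          {ω : Fin k × Fin T → ℝ | ∀ i : Fin T,
            (1 - ε) * ∑ j, (x i j) ^ 2 ≤
                ∑ l, ((Matrix.of fun l j => ω (l, j)).mulVec (x i) l) ^ 2 ∧
              ∑ l, ((Matrix.of fun l j => ω (l, j)).mulVec (x i) l) ^ 2 ≤
                (1 + ε) * ∑ j, (x i j) ^ 2}) ∧
      1 - 2 * (T : ℝ) ^ (-(1 / 4 : ℝ)) ≤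
        1 - 2 * T * Real.exp (-(ε ^ 2 - ε ^ 3) * k / 4) := by
  obtain ⟨h0, h1⟩ := hε
  have hc : 0 < ε ^ 2 - ε ^ 3 := by
    have : ε ^ 2 - ε ^ 3 = ε ^ 2 * (1 - ε) := by ring
    rw [this]
    exact mul_pos (by positivity) (by linarith)
  have hT' : (2:ℝ) ≤ T := by exact_mod_cast hT
  have hlog : 0 < Real.log T := Real.log_pos (by linarith)
  have hk0 : 0 < k := by
    have : (0:ℝ) < k := lt_of_lt_of_le (by positivity) hk
    exact_mod_cast this
  constructor
  · simp only [Matrix.mulVec, dotProduct, Matrix.of_apply]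
    rw [← (curry_mp k T _).measure_preimage (by
      refine MeasurableSet.nullMeasurableSet ?_
      rw [Set.ofPred_forall]
      refine MeasurableSet.iInter fun i => ?_
      rw [Set.ofPred_and]
      exact (measurableSet_le (by fun_prop) (by fun_prop)).inter
        (measurableSet_le (by fun_prop) (by fun_prop)))]
    simp only [Set.preimage_ofPred_eq]
    rw [ENNReal.ofReal_le_iff_le_toReal (measure_ne_top _ _), ← measureReal_def]
    rw [← compl_compl {a : Fin k → Fin T → ℝ | ∀ i : Fin T, _}, probReal_compl_eq_one_sub (by
      refine MeasurableSet.compl ?_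
      rw [Set.ofPred_forall]
      refine MeasurableSet.iInter fun i => ?_
      rw [Set.ofPred_and]
      exact (measurableSet_le (by fun_prop) (by fun_prop)).inter
        (measurableSet_le (by fun_prop) (by fun_prop)))]
    apply sub_le_sub_left
    rw [Set.compl_ofPred]
    simp only [not_forall]
    rw [Set.ofPred_exists]
    refine (measureReal_iUnion_fintype_le _).trans ?_
    refine (Finset.sum_le_sum fun i _ => jl_one k T hk0 (x i) ε h0 h1).trans ?_
    simp
    linarith
  · have h2 : 5 * Real.log T ≤ k * (ε ^ 2 - ε ^ 3) := (div_le_iff₀ hc).1 hk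
    have h3 : T * Real.exp (-(ε ^ 2 - ε ^ 3) * k / 4) ≤ (T : ℝ) ^ (-(1 / 4 : ℝ)) := by
      have hTp : (0:ℝ) < T := by linarith
      rw [Real.rpow_def_of_pos hTp]
      nth_rw 1 [← Real.exp_log hTp]
      rw [← Real.exp_add]
      apply Real.exp_le_exp.2
      linarith
    linarith
end
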